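/- arXiv:1912.11788 — 2 statements merged into one kernel-verified Lean document; each statement's English description precedes it below -/
import Mathlib

section
/- Let g_0, g_1 : ℝ → SE(2) be differentiable curves satisfying g_i′(t) = g_i(t) ξ̂_i(t), where ξ̂_i : ℝ → se(2) are differentiable with ξ̂_i′(t) = û_i(t). Let g_{01} = g_0⁻¹ g_1 and ξ̂_{01} = ξ̂_1 − Ad_{g_{01}⁻¹} ξ̂_0. Then the relative velocity satisfies the dynamics ξ̂_{01}′(t) = û_1(t) − Ad_{g_{01}(t)⁻¹} û_0(t) − [ξ̂_1(t), ξ̂_{01}(t)]. -/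
open Matrix Filter Real

/-- The SE(2) element with rotation angle `θ` and translation vector `(x, y)`. -/
noncomputable def SE2mat (θ x y : ℝ) : Matrix (Fin 3) (Fin 3) ℝ :=
  !![Real.cos θ, -Real.sin θ, x; Real.sin θ, Real.cos θ, y; 0, 0, 1]

/-- The se(2) element with vector form `(ω, v_x, v_y)`. -/
def se2mat (ω vx vy : ℝ) : Matrix (Fin 3) (Fin 3) ℝ :=
  !![0, -ω, vx; ω, 0, vy; 0, 0, 0]

/-- Membership in SE(2). -/
def IsSE2 (g : Matrix (Fin 3) (Fin 3) ℝ) : Prop := ∃ θ x y : ℝ, g = SE2mat θ x y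

/-- Membership in se(2). -/
def Isse2 (ξ : Matrix (Fin 3) (Fin 3) ℝ) : Prop := ∃ ω vx vy : ℝ, ξ = se2mat ω vx vy

/-- The adjoint map `Ad_g X = g X g⁻¹`. -/
noncomputable def Adj (g X : Matrix (Fin 3) (Fin 3) ℝ) : Matrix (Fin 3) (Fin 3) ℝ :=
  g * X * g⁻¹

/-- The matrix commutator `[X, Y] = X Y − Y X`. -/
def matComm (X Y : Matrix (Fin 3) (Fin 3) ℝ) : Matrix (Fin 3) (Fin 3) ℝ := X * Y - Y * X

attribute [local instance] Matrix.normedAddCommGroup Matrix.normedSpace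

/-- Product rule for curves of matrices. -/
theorem HasDerivAt.matrix_mul {n : Type*} [Fintype n] {A B : ℝ → Matrix n n ℝ}
    {A' B' : Matrix n n ℝ} {t : ℝ} (hA : HasDerivAt A A' t) (hB : HasDerivAt B B' t) :
    HasDerivAt (fun s => A s * B s) (A' * B t + A t * B') t := by
  classical
  let := Matrix.linftyOpNormedRing (n := n) (α := ℝ)
  let := Matrix.linftyOpNormedAlgebra (n := n) (R := ℝ) (α := ℝ)
  exact HasDerivAt.mul (𝔸 := Matrix n n ℝ) hA hB

/-- Derivative of the inverse of a curve in a complete normed algebra. -/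
theorem HasDerivAt.ringInverse {R : Type*} [NormedRing R] [NormedAlgebra ℝ R] [CompleteSpace R]
    {A : ℝ → R} {A' : R} {t : ℝ} (hA : HasDerivAt A A' t) (h : IsUnit (A t)) :
    HasDerivAt (fun s => Ring.inverse (A s)) (-(Ring.inverse (A t) * A' * Ring.inverse (A t))) t := by
  obtain ⟨u, hu⟩ := h
  have := HasFDerivAt.comp_hasDerivAt_of_eq t (hasFDerivAt_ringInverse (𝕜 := ℝ) u) hA hu
  simpa [← hu, Function.comp_def] using this

/-- Derivative of the inverse of a curve of invertible matrices. -/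
theorem HasDerivAt.matrix_inv {n : Type*} [Fintype n] [DecidableEq n] {A : ℝ → Matrix n n ℝ}
    {A' : Matrix n n ℝ} {t : ℝ} (hA : HasDerivAt A A' t) (h : IsUnit (A t)) :
    HasDerivAt (fun s => (A s)⁻¹) (-((A t)⁻¹ * A' * (A t)⁻¹)) t := by
  let := Matrix.linftyOpNormedRing (n := n) (α := ℝ)
  let := Matrix.linftyOpNormedAlgebra (n := n) (R := ℝ) (α := ℝ)
  have hc : CompleteSpace (Matrix n n ℝ) := inferInstance
  simp only [Matrix.nonsing_inv_eq_ringInverse]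
  exact @HasDerivAt.ringInverse (Matrix n n ℝ) _ _ hc _ _ _ hA h

theorem IsSE2.isUnit {g : Matrix (Fin 3) (Fin 3) ℝ} (h : IsSE2 g) : IsUnit g := by
  obtain ⟨θ, x, y, rfl⟩ := h
  rw [Matrix.isUnit_iff_isUnit_det]
  have : (SE2mat θ x y).det = 1 := by
    simp [SE2mat, Matrix.det_fin_three, ← sq]
  simp [this]

/-- the relative velocity `ξ̂₀₁ = ξ̂₁ − Ad_{g₀₁⁻¹} ξ̂₀` satisfies
`ξ̂₀₁′ = û₁ − Ad_{g₀₁⁻¹} û₀ − [ξ̂₁, ξ̂₀₁]`. -/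
theorem relative_velocity_dynamics
    (g0 g1 ξ0 ξ1 u0 u1 : ℝ → Matrix (Fin 3) (Fin 3) ℝ)
    (hg0 : ∀ t : ℝ, IsSE2 (g0 t)) (hg1 : ∀ t : ℝ, IsSE2 (g1 t))
    (hξ0 : ∀ t : ℝ, Isse2 (ξ0 t)) (hξ1 : ∀ t : ℝ, Isse2 (ξ1 t))
    (hd0 : ∀ t : ℝ, HasDerivAt g0 (g0 t * ξ0 t) t)
    (hd1 : ∀ t : ℝ, HasDerivAt g1 (g1 t * ξ1 t) t)
    (hu0 : ∀ t : ℝ, HasDerivAt ξ0 (u0 t) t)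
    (hu1 : ∀ t : ℝ, HasDerivAt ξ1 (u1 t) t) (t : ℝ) :
    HasDerivAt (fun s => ξ1 s - Adj ((g0 s)⁻¹ * g1 s)⁻¹ (ξ0 s))
      (u1 t - Adj ((g0 t)⁻¹ * g1 t)⁻¹ (u0 t) -
        matComm (ξ1 t) (ξ1 t - Adj ((g0 t)⁻¹ * g1 t)⁻¹ (ξ0 t))) t := by
  have h0 := (hg0 t).isUnit
  have h1 := (hg1 t).isUnit
  have hA := ((hd0 t).matrix_inv h0).matrix_mul (hd1 t)
  have hunit : IsUnit ((g0 t)⁻¹ * g1 t) := (Matrix.isUnit_nonsing_inv_iff.2 h0).mul h1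
  have hB := hA.matrix_inv hunit
  have hinv (s : ℝ) : ((g0 s)⁻¹ * g1 s)⁻¹⁻¹ = (g0 s)⁻¹ * g1 s :=
    Matrix.nonsing_inv_nonsing_inv _ ((Matrix.isUnit_iff_isUnit_det _).1
      ((Matrix.isUnit_nonsing_inv_iff.2 (hg0 s).isUnit).mul (hg1 s).isUnit))
  simp only [Adj, hinv, matComm]
  refine ((hu1 t).sub ((hB.matrix_mul (hu0 t)).matrix_mul hA)).congr_deriv ?_
  have e0 : (g0 t)⁻¹ * g0 t = 1 :=
    Matrix.nonsing_inv_mul _ ((Matrix.isUnit_iff_isUnit_det _).1 h0)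
  have hA' : -((g0 t)⁻¹ * (g0 t * ξ0 t) * (g0 t)⁻¹) * g1 t + (g0 t)⁻¹ * (g1 t * ξ1 t) =
      (g0 t)⁻¹ * g1 t * ξ1 t - ξ0 t * ((g0 t)⁻¹ * g1 t) := by
    rw [← mul_assoc (g0 t)⁻¹ (g0 t), e0]
    noncomm_ring
  rw [hA']
  generalize (g0 t)⁻¹ * g1 t = A at hunit ⊢
  rw [Matrix.isUnit_iff_isUnit_det] at hunit
  have eL : A⁻¹ * (A * ξ1 t - ξ0 t * A) * A⁻¹ = ξ1 t * A⁻¹ - A⁻¹ * ξ0 t := by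
    rw [mul_sub, sub_mul, Matrix.nonsing_inv_mul_cancel_left _ _ hunit, ← mul_assoc A⁻¹,
      Matrix.mul_nonsing_inv_cancel_right _ _ hunit]
  have eR : A⁻¹ * ξ0 t * (A * ξ1 t - ξ0 t * A) =
      A⁻¹ * ξ0 t * A * ξ1 t - A⁻¹ * ξ0 t * ξ0 t * A := by
    noncomm_ring
  rw [eL, eR]
  noncomm_ring
end

section
/- Let ω_0, v_{x0}, ω̃_1, ṽ_{x1}, r_x, r_y ∈ ℝ with v_{x0} − ω_0 r_y ≠ 0, and set the adjoint attitude angle θ̃_{01} = arctan( ω_0 r_x / (v_{x0} − ω_0 r_y) ). Let g̃_{01} ∈ SE(2) have rotation angle θ̃_{01} and translation vector (r_x, r_y), let ξ̂_0 ∈ se(2) have vector form (ω_0, v_{x0}, 0), and let ξ̂̃_1 ∈ se(2) have vector form (ω̃_1, ṽ_{x1}, 0) (i.e., its side velocity ṽ_{y1} = 0). Then the third (side-velocity) component of the vector form of ξ̂̃_1 − Ad_{g̃_{01}⁻¹} ξ̂_0 is zero; that is, the relative system between the auxiliary system and the leader satisfies the nonholonomic constraint. -/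
open Matrix Filter Real

theorem SE2mat_inv (θ x y : ℝ) :
    (SE2mat θ x y)⁻¹ =
      SE2mat (-θ) (-(cos θ * x + sin θ * y)) (sin θ * x - cos θ * y) := by
  refine Matrix.inv_eq_left_inv ?_
  ext i j
  fin_cases i <;> fin_cases j <;>
    simp [SE2mat, Matrix.mul_apply, Fin.sum_univ_three] <;>
    first
    | ring1
    | linear_combination Real.sin_sq_add_cos_sq θ

theorem det_SE2mat (θ x y : ℝ) : (SE2mat θ x y).det = 1 := by
  simp [SE2mat, Matrix.det_fin_three, ← sq]

/-- The side velocity of `Ad_{g⁻¹} ξ` for `ξ` without side velocity. -/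
theorem Adj_SE2mat_inv_side_velocity (θ x y ω vx : ℝ) :
    Adj (SE2mat θ x y)⁻¹ (se2mat ω vx 0) 1 2 =
      cos θ * (ω * x) - sin θ * (vx - ω * y) := by
  rw [Adj, Matrix.nonsing_inv_nonsing_inv _ (by simp [det_SE2mat]), SE2mat_inv]
  simp [SE2mat, se2mat, Matrix.mul_apply, Fin.sum_univ_three]
  ring

/-- with the adjoint attitude angle `θ̃₀₁ = arctan(ω₀ r_x / (v_{x0} − ω₀ r_y))`
and a side-velocity-free auxiliary system, the relative velocity between the auxiliary
system and the leader has zero side-velocity component, i.e. it satisfies the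
nonholonomic constraint. -/
theorem adjoint_attitude_gives_nonholonomic (ω0 vx0 ωt1 vt1 rx ry : ℝ)
    (h : vx0 - ω0 * ry ≠ 0) :
    (se2mat ωt1 vt1 0 -
        Adj (SE2mat (Real.arctan (ω0 * rx / (vx0 - ω0 * ry))) rx ry)⁻¹
          (se2mat ω0 vx0 0)) 1 2 = 0 := by
  have hsin := Real.tan_mul_cos (Real.cos_arctan_pos (ω0 * rx / (vx0 - ω0 * ry))).ne'
  rw [Real.tan_arctan] at hsin
  rw [Matrix.sub_apply, Adj_SE2mat_inv_side_velocity, ← hsin]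
  simp only [se2mat, Matrix.of_apply, Matrix.cons_val]
  field_simp
  ring
end
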